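/- Composed simulations without confluence: for every closed term M of the algebraic λ-calculus and every value V, (i) if M →ℓ∪β* V then (M~) λx.x (=a∪β)* Ψ(V), and (ii) if M →a∪β* V then (⟦M⟧) λx.x (=ℓ∪β)* Φ(V). (Here R* denotes the reflexive-transitive closure of a relation R.) -/

import Mathlib

namespace AlgLam

/-- Terms of the algebraic λ-calculus over a ring of scalars `R`,
    in de Bruijn representation. -/
inductive Term (R : Type u) : Type u
  | var : ℕ → Term R
  | lam : Term R → Term R
  | app : Term R → Term R → Term R
  | zero : Term R
  | smul : R → Term R → Term R
  | add : Term R → Term R → Term R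

namespace Term

variable {R : Type u}

/-- De Bruijn lifting: shift the free indices `≥ d` up by one. -/
def lift (d : ℕ) : Term R → Term R
  | var n => if n < d then var n else var (n + 1)
  | lam M => lam (lift (d + 1) M)
  | app M N => app (lift d M) (lift d N)
  | zero => zero
  | smul a M => smul a (lift d M)
  | add M N => add (lift d M) (lift d N)

/-- Capture-avoiding substitution of `N` for the free de Bruijn index `d`. -/
def subst (d : ℕ) (N : Term R) : Term R → Term R
  | var n => if n < d then var n else if n = d then N else var (n - 1)
  | lam M => lam (subst (d + 1) (lift 0 N) M)
  | app M L => app (subst d N M) (subst d N L)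
  | zero => zero
  | smul a M => smul a (subst d N M)
  | add M L => add (subst d N M) (subst d N L)

/-- Base terms: variables and λ-abstractions. -/
inductive IsBase : Term R → Prop
  | var (n : ℕ) : IsBase (var n)
  | lam (M : Term R) : IsBase (lam M)

/-- Values: `0`, base terms, scalar multiples of values, sums of values. -/
inductive IsValue : Term R → Prop
  | zero : IsValue zero
  | base {B : Term R} : IsBase B → IsValue B
  | smul (a : R) {V : Term R} : IsValue V → IsValue (smul a V)
  | add {V W : Term R} : IsValue V → IsValue W → IsValue (add V W)

/-- `ClosedUnder d M` : every free index of `M` is `< d`. -/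
def ClosedUnder : ℕ → Term R → Prop
  | d, var n => n < d
  | d, lam M => ClosedUnder (d + 1) M
  | d, app M N => ClosedUnder d M ∧ ClosedUnder d N
  | _, zero => True
  | d, smul _ M => ClosedUnder d M
  | d, add M N => ClosedUnder d M ∧ ClosedUnder d N

/-- A closed term (a program). -/
def Closed (M : Term R) : Prop := ClosedUnder 0 M

section Rules

variable [CommRing R]

/-- The rewrite relation `→a` of the call-by-name algebraic λ-calculus:
    ring rules and call-by-name application rules, closed under the ξ contexts. -/
inductive StepA : Term R → Term R → Prop
  -- ring rules
  | assocL (M N L : Term R) : StepA (add M (add N L)) (add (add M N) L)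
  | assocR (M N L : Term R) : StepA (add (add M N) L) (add M (add N L))
  | comm (M N : Term R) : StepA (add M N) (add N M)
  | factor (a b : R) (M : Term R) : StepA (add (smul a M) (smul b M)) (smul (a + b) M)
  | factor1 (a : R) (M : Term R) : StepA (add (smul a M) M) (smul (a + 1) M)
  | factor11 (M : Term R) : StepA (add M M) (smul (1 + 1) M)
  | mulMul (a b : R) (M : Term R) : StepA (smul a (smul b M)) (smul (a * b) M)
  | mulDist (a : R) (M N : Term R) : StepA (smul a (add M N)) (add (smul a M) (smul a N))
  | oneSmul (M : Term R) : StepA (smul 1 M) M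
  | zeroSmul (M : Term R) : StepA (smul 0 M) zero
  | smulZero (a : R) : StepA (smul a zero) zero
  | zeroAdd (M : Term R) : StepA (add zero M) M
  -- call-by-name application rules (A)
  | appAdd (M N L : Term R) : StepA (app (add M N) L) (add (app M L) (app N L))
  | appSmul (a : R) (M N : Term R) : StepA (app (smul a M) N) (smul a (app M N))
  | appZero (M : Term R) : StepA (app zero M) zero
  -- ξ context rules
  | ctxAppL {M M' : Term R} (N : Term R) : StepA M M' → StepA (app M N) (app M' N)
  | ctxAddL {M M' : Term R} (N : Term R) : StepA M M' → StepA (add M N) (add M' N)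
  | ctxAddR {N N' : Term R} (M : Term R) : StepA N N' → StepA (add M N) (add M N')
  | ctxSmul (a : R) {M M' : Term R} : StepA M M' → StepA (smul a M) (smul a M')

/-- The call-by-name β-reduction `→βn`, closed under the ξ contexts. -/
inductive StepBn : Term R → Term R → Prop
  | beta (M N : Term R) : StepBn (app (lam M) N) (subst 0 N M)
  | ctxAppL {M M' : Term R} (N : Term R) : StepBn M M' → StepBn (app M N) (app M' N)
  | ctxAddL {M M' : Term R} (N : Term R) : StepBn M M' → StepBn (add M N) (add M' N)
  | ctxAddR {N N' : Term R} (M : Term R) : StepBn N N' → StepBn (add M N) (add M N')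
  | ctxSmul (a : R) {M M' : Term R} : StepBn M M' → StepBn (smul a M) (smul a M')

/-- The rewrite relation `→a∪β`. -/
def StepAB (M N : Term R) : Prop := StepA M N ∨ StepBn M N

/-- The rewrite relation `→ℓ` of the call-by-value algebraic λ-calculus:
    ring rules, left- and right-linearity rules, closed under ξ and ξ_lin. -/
inductive StepL : Term R → Term R → Prop
  -- ring rules
  | assocL (M N L : Term R) : StepL (add M (add N L)) (add (add M N) L)
  | assocR (M N L : Term R) : StepL (add (add M N) L) (add M (add N L))
  | comm (M N : Term R) : StepL (add M N) (add N M)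
  | factor (a b : R) (M : Term R) : StepL (add (smul a M) (smul b M)) (smul (a + b) M)
  | factor1 (a : R) (M : Term R) : StepL (add (smul a M) M) (smul (a + 1) M)
  | factor11 (M : Term R) : StepL (add M M) (smul (1 + 1) M)
  | mulMul (a b : R) (M : Term R) : StepL (smul a (smul b M)) (smul (a * b) M)
  | mulDist (a : R) (M N : Term R) : StepL (smul a (add M N)) (add (smul a M) (smul a N))
  | oneSmul (M : Term R) : StepL (smul 1 M) M
  | zeroSmul (M : Term R) : StepL (smul 0 M) zero
  | smulZero (a : R) : StepL (smul a zero) zero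
  | zeroAdd (M : Term R) : StepL (add zero M) M
  -- left linearity (A_l), the argument must be a value
  | appAddV {V : Term R} (M N : Term R) : IsValue V →
      StepL (app (add M N) V) (add (app M V) (app N V))
  | appSmulV {V : Term R} (a : R) (M : Term R) : IsValue V →
      StepL (app (smul a M) V) (smul a (app M V))
  | appZeroV {V : Term R} : IsValue V → StepL (app zero V) zero
  -- right linearity (A_r), the function must be a base term
  | appAddB {B : Term R} (M N : Term R) : IsBase B →
      StepL (app B (add M N)) (add (app B M) (app B N))
  | appSmulB {B : Term R} (a : R) (M : Term R) : IsBase B →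
      StepL (app B (smul a M)) (smul a (app B M))
  | appZeroB {B : Term R} : IsBase B → StepL (app B zero) zero
  -- ξ context rules
  | ctxAppL {M M' : Term R} (N : Term R) : StepL M M' → StepL (app M N) (app M' N)
  | ctxAddL {M M' : Term R} (N : Term R) : StepL M M' → StepL (add M N) (add M' N)
  | ctxAddR {N N' : Term R} (M : Term R) : StepL N N' → StepL (add M N) (add M N')
  | ctxSmul (a : R) {M M' : Term R} : StepL M M' → StepL (smul a M) (smul a M')
  -- ξ_lin context rule
  | ctxAppR {V M M' : Term R} : IsValue V → StepL M M' → StepL (app V M) (app V M')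

/-- The call-by-value β-reduction `→βv`, closed under ξ and ξ_lin. -/
inductive StepBv : Term R → Term R → Prop
  | beta (M : Term R) {B : Term R} : IsBase B → StepBv (app (lam M) B) (subst 0 B M)
  | ctxAppL {M M' : Term R} (N : Term R) : StepBv M M' → StepBv (app M N) (app M' N)
  | ctxAddL {M M' : Term R} (N : Term R) : StepBv M M' → StepBv (add M N) (add M' N)
  | ctxAddR {N N' : Term R} (M : Term R) : StepBv N N' → StepBv (add M N) (add M N')
  | ctxSmul (a : R) {M M' : Term R} : StepBv M M' → StepBv (smul a M) (smul a M')
  | ctxAppR {V M M' : Term R} : IsValue V → StepBv M M' → StepBv (app V M) (app V M')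

/-- The rewrite relation `→ℓ∪β`. -/
def StepLB (M N : Term R) : Prop := StepL M N ∨ StepBv M N

end Rules

/-- Steps of `→a` performed by an associativity or commutativity rule
    (closed under the ξ contexts). -/
inductive StepACa : Term R → Term R → Prop
  | assocL (M N L : Term R) : StepACa (add M (add N L)) (add (add M N) L)
  | assocR (M N L : Term R) : StepACa (add (add M N) L) (add M (add N L))
  | comm (M N : Term R) : StepACa (add M N) (add N M)
  | ctxAppL {M M' : Term R} (N : Term R) : StepACa M M' → StepACa (app M N) (app M' N)
  | ctxAddL {M M' : Term R} (N : Term R) : StepACa M M' → StepACa (add M N) (add M' N)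
  | ctxAddR {N N' : Term R} (M : Term R) : StepACa N N' → StepACa (add M N) (add M N')
  | ctxSmul (a : R) {M M' : Term R} : StepACa M M' → StepACa (smul a M) (smul a M')

/-- Steps of `→ℓ` performed by an associativity or commutativity rule
    (closed under the ξ and ξ_lin contexts). -/
inductive StepACl : Term R → Term R → Prop
  | assocL (M N L : Term R) : StepACl (add M (add N L)) (add (add M N) L)
  | assocR (M N L : Term R) : StepACl (add (add M N) L) (add M (add N L))
  | comm (M N : Term R) : StepACl (add M N) (add N M)
  | ctxAppL {M M' : Term R} (N : Term R) : StepACl M M' → StepACl (app M N) (app M' N)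
  | ctxAddL {M M' : Term R} (N : Term R) : StepACl M M' → StepACl (add M N) (add M' N)
  | ctxAddR {N N' : Term R} (M : Term R) : StepACl N N' → StepACl (add M N) (add M N')
  | ctxSmul (a : R) {M M' : Term R} : StepACl M M' → StepACl (smul a M) (smul a M')
  | ctxAppR {V M M' : Term R} : IsValue V → StepACl M M' → StepACl (app V M) (app V M')

section NonAC

variable [CommRing R]

/-- Steps of `→a` performed by a rule other than associativity or commutativity of `+`
    (closed under the ξ contexts). -/
inductive StepNAa : Term R → Term R → Prop
  | factor (a b : R) (M : Term R) : StepNAa (add (smul a M) (smul b M)) (smul (a + b) M)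
  | factor1 (a : R) (M : Term R) : StepNAa (add (smul a M) M) (smul (a + 1) M)
  | factor11 (M : Term R) : StepNAa (add M M) (smul (1 + 1) M)
  | mulMul (a b : R) (M : Term R) : StepNAa (smul a (smul b M)) (smul (a * b) M)
  | mulDist (a : R) (M N : Term R) : StepNAa (smul a (add M N)) (add (smul a M) (smul a N))
  | oneSmul (M : Term R) : StepNAa (smul 1 M) M
  | zeroSmul (M : Term R) : StepNAa (smul 0 M) zero
  | smulZero (a : R) : StepNAa (smul a zero) zero
  | zeroAdd (M : Term R) : StepNAa (add zero M) M
  | appAdd (M N L : Term R) : StepNAa (app (add M N) L) (add (app M L) (app N L))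
  | appSmul (a : R) (M N : Term R) : StepNAa (app (smul a M) N) (smul a (app M N))
  | appZero (M : Term R) : StepNAa (app zero M) zero
  | ctxAppL {M M' : Term R} (N : Term R) : StepNAa M M' → StepNAa (app M N) (app M' N)
  | ctxAddL {M M' : Term R} (N : Term R) : StepNAa M M' → StepNAa (add M N) (add M' N)
  | ctxAddR {N N' : Term R} (M : Term R) : StepNAa N N' → StepNAa (add M N) (add M N')
  | ctxSmul (a : R) {M M' : Term R} : StepNAa M M' → StepNAa (smul a M) (smul a M')

/-- Steps of `→ℓ` performed by a rule other than associativity or commutativity of `+`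
    (closed under the ξ and ξ_lin contexts). -/
inductive StepNAl : Term R → Term R → Prop
  | factor (a b : R) (M : Term R) : StepNAl (add (smul a M) (smul b M)) (smul (a + b) M)
  | factor1 (a : R) (M : Term R) : StepNAl (add (smul a M) M) (smul (a + 1) M)
  | factor11 (M : Term R) : StepNAl (add M M) (smul (1 + 1) M)
  | mulMul (a b : R) (M : Term R) : StepNAl (smul a (smul b M)) (smul (a * b) M)
  | mulDist (a : R) (M N : Term R) : StepNAl (smul a (add M N)) (add (smul a M) (smul a N))
  | oneSmul (M : Term R) : StepNAl (smul 1 M) M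
  | zeroSmul (M : Term R) : StepNAl (smul 0 M) zero
  | smulZero (a : R) : StepNAl (smul a zero) zero
  | zeroAdd (M : Term R) : StepNAl (add zero M) M
  | appAddV {V : Term R} (M N : Term R) : IsValue V →
      StepNAl (app (add M N) V) (add (app M V) (app N V))
  | appSmulV {V : Term R} (a : R) (M : Term R) : IsValue V →
      StepNAl (app (smul a M) V) (smul a (app M V))
  | appZeroV {V : Term R} : IsValue V → StepNAl (app zero V) zero
  | appAddB {B : Term R} (M N : Term R) : IsBase B →
      StepNAl (app B (add M N)) (add (app B M) (app B N))
  | appSmulB {B : Term R} (a : R) (M : Term R) : IsBase B →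
      StepNAl (app B (smul a M)) (smul a (app B M))
  | appZeroB {B : Term R} : IsBase B → StepNAl (app B zero) zero
  | ctxAppL {M M' : Term R} (N : Term R) : StepNAl M M' → StepNAl (app M N) (app M' N)
  | ctxAddL {M M' : Term R} (N : Term R) : StepNAl M M' → StepNAl (add M N) (add M' N)
  | ctxAddR {N N' : Term R} (M : Term R) : StepNAl N N' → StepNAl (add M N) (add M N')
  | ctxSmul (a : R) {M M' : Term R} : StepNAl M M' → StepNAl (smul a M) (smul a M')
  | ctxAppR {V M M' : Term R} : IsValue V → StepNAl M M' → StepNAl (app V M) (app V M')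

end NonAC

/-- The call-by-value-to-call-by-name encoding `M ↦ M~`.
    The fresh variables `f`, `g`, `h` are handled by de Bruijn lifting. -/
def cbvEnc : Term R → Term R
  | var n => lam (app (var 0) (var (n + 1)))
  | zero => zero
  | lam M => lam (app (var 0) (lift 0 (lam (cbvEnc M))))
  | app M N =>
      lam (app (lift 0 (cbvEnc M))
        (lam (app (lift 0 (lift 0 (cbvEnc N)))
          (lam (app (app (var 1) (var 0)) (var 2))))))
  | smul a M => lam (app (smul a (lift 0 (cbvEnc M))) (var 0))
  | add M N => lam (app (add (lift 0 (cbvEnc M)) (lift 0 (cbvEnc N))) (var 0))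

/-- The value encoding `Ψ` (its value on non-values is irrelevant). -/
def psi : Term R → Term R
  | var n => var n
  | zero => zero
  | lam M => lam (cbvEnc M)
  | smul a V => smul a (psi V)
  | add V W => add (psi V) (psi W)
  | app M N => app (psi M) (psi N)

/-- The call-by-name-to-call-by-value encoding `M ↦ ⟦M⟧`. -/
def cbnEnc : Term R → Term R
  | var n => var n
  | zero => lam (app zero (var 0))
  | lam M => lam (app (var 0) (lift 0 (lam (cbnEnc M))))
  | app M N =>
      lam (app (lift 0 (cbnEnc M))
        (lam (app (app (var 0) (lift 0 (lift 0 (cbnEnc N)))) (var 1))))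
  | smul a M => lam (app (smul a (lift 0 (cbnEnc M))) (var 0))
  | add M N => lam (app (add (lift 0 (cbnEnc M)) (lift 0 (cbnEnc N))) (var 0))

/-- The value encoding `Φ` (its value on non-values is irrelevant). -/
def phi : Term R → Term R
  | var n => app (var n) (lam (var 0))
  | zero => zero
  | lam M => lam (cbnEnc M)
  | smul a V => smul a (phi V)
  | add V W => add (phi V) (phi W)
  | app M N => app (phi M) (phi N)

/-- A measure on terms used to define the administrative operation `(:)`. -/
def size : Term R → ℕ
  | var _ => 1
  | lam _ => 1
  | zero => 1
  | smul _ M => 1 + size M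
  | add M N => 1 + size M + size N
  | app M N => size M * (size N + 1)

theorem size_pos : ∀ M : Term R, 0 < size M
  | var _ => Nat.one_pos
  | lam _ => Nat.one_pos
  | zero => Nat.one_pos
  | smul _ M => by simp [size]
  | add M N => by simp [size]
  | app M N => Nat.mul_pos (size_pos M) (Nat.succ_pos _)

/-- The administrative infix operation `(:)` of the call-by-value to call-by-name
    simulation: `colon M K` is `M : K`. -/
def colon : Term R → Term R → Term R
  | zero, _ => zero
  | var n, K => app K (var n)
  | lam M, K => app K (lam (cbvEnc M))
  | smul a M, K => smul a (colon M K)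
  | add M N, K => add (colon M K) (colon N K)
  | app zero _, _ => zero
  | app (var n) N, K =>
      colon N (lam (app (app (var (n + 1)) (var 0)) (lift 0 K)))
  | app (lam M) N, K =>
      colon N (lam (app (app (lift 0 (lam (cbvEnc M))) (var 0)) (lift 0 K)))
  | app (smul a M) N, K => smul a (colon (app M N) K)
  | app (add M M') N, K => add (colon (app M N) K) (colon (app M' N) K)
  | app (app M M') L, K =>
      colon (app M M')
        (lam (app (lift 0 (cbvEnc L))
          (lam (app (app (var 1) (var 0)) (lift 0 (lift 0 K))))))
termination_by M _ => size M
decreasing_by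
  all_goals simp only [size]
  · omega
  · omega
  · omega
  · nlinarith [size_pos N]
  · nlinarith [size_pos N]
  · nlinarith [size_pos M, size_pos N]
  · nlinarith [size_pos M, size_pos M', size_pos N]
  · nlinarith [size_pos M, size_pos M', size_pos N]
  · nlinarith [size_pos L, Nat.mul_pos (size_pos M) (Nat.succ_pos (size M'))]



section Equalities

variable [CommRing R]

/-- The restricted algebraic equality `=ℓ^F` on a fragment `F`. -/
def EqL (F : Set (Term R)) (M N : Term R) : Prop :=
  M ∈ F ∧ N ∈ F ∧ (StepL M N ∨ StepL N M)

/-- The relation `=ℓ∪β^F` : restricted algebraic equality together with `→βv` restricted to `F`. -/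
def EqLB (F : Set (Term R)) (M N : Term R) : Prop :=
  EqL F M N ∨ (M ∈ F ∧ N ∈ F ∧ StepBv M N)

/-- The restricted algebraic equality `=a^F` on a fragment `F`. -/
def EqA (F : Set (Term R)) (M N : Term R) : Prop :=
  M ∈ F ∧ N ∈ F ∧ (StepA M N ∨ StepA N M)

/-- The relation `=a∪β^F` : restricted algebraic equality together with `→βn` restricted to `F`. -/
def EqAB (F : Set (Term R)) (M N : Term R) : Prop :=
  EqA F M N ∨ (M ∈ F ∧ N ∈ F ∧ StepBn M N)

/-- The unrestricted algebraic equality `=ℓ` (symmetric closure of `→ℓ`). -/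
def EqLfull (M N : Term R) : Prop := StepL M N ∨ StepL N M

/-- The unrestricted relation `=ℓ∪β`. -/
def EqLBfull (M N : Term R) : Prop := EqLfull M N ∨ StepBv M N

/-- The unrestricted algebraic equality `=a` (symmetric closure of `→a`). -/
def EqAfull (M N : Term R) : Prop := StepA M N ∨ StepA N M

/-- The unrestricted relation `=a∪β`. -/
def EqABfull (M N : Term R) : Prop := EqAfull M N ∨ StepBn M N

end Equalities

/-! ### Lifting and substitution -/

section Substitution

theorem lift_lift (M : Term R) : ∀ {i d : ℕ}, i ≤ d →
    lift (d + 1) (lift i M) = lift i (lift d M) := by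
  induction M with
  | var n =>
    intro i d h
    simp only [lift]
    split_ifs <;> simp only [lift] <;> split_ifs <;> first | rfl | omega
  | lam M ih => intro i d h; simp only [lift, ih (Nat.succ_le_succ h)]
  | app M N ihM ihN => intro i d h; simp only [lift, ihM h, ihN h]
  | zero => intros; rfl
  | smul a M ih => intro i d h; simp only [lift, ih h]
  | add M N ihM ihN => intro i d h; simp only [lift, ihM h, ihN h]

theorem subst_lift_self (M : Term R) : ∀ (d : ℕ) (N : Term R), subst d N (lift d M) = M := by
  induction M with
  | var n =>
    intro d N
    simp only [lift]
    split_ifs <;> simp only [subst] <;> split_ifs <;> first | rfl | omega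
  | lam M ih => intro d N; simp only [lift, subst, ih]
  | app M N ihM ihN => intro d L; simp only [lift, subst, ihM, ihN]
  | zero => intros; rfl
  | smul a M ih => intro d N; simp only [lift, subst, ih]
  | add M N ihM ihN => intro d L; simp only [lift, subst, ihM, ihN]

theorem subst_lift (M : Term R) : ∀ {i d : ℕ} (N : Term R), i ≤ d →
    subst (d + 1) (lift i N) (lift i M) = lift i (subst d N M) := by
  induction M with
  | var n =>
    intro i d N h
    rcases lt_trichotomy n d with hn | rfl | hn
    · by_cases hi : n < i
      · simp [lift, subst, hn, hi, show n < d + 1 by omega]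
      · simp [lift, subst, hn, hi]
    · simp [lift, subst, Nat.not_lt.2 h]
    · have e : n - 1 + 1 = n := by omega
      simp [lift, subst, show ¬ n < d by omega, show ¬ n = d by omega, show ¬ n < i by omega,
        show ¬ n - 1 < i by omega, e]
  | lam M ih =>
    intro i d N h
    simp only [lift, subst]
    rw [← lift_lift N (Nat.zero_le i), ih _ (Nat.succ_le_succ h)]
  | app M N ihM ihN => intro i d L h; simp only [lift, subst, ihM _ h, ihN _ h]
  | zero => intros; rfl
  | smul a M ih => intro i d N h; simp only [lift, subst, ih _ h]
  | add M N ihM ihN => intro i d L h; simp only [lift, subst, ihM _ h, ihN _ h]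

theorem subst_one_lift (N M : Term R) :
    subst 1 (lift 0 N) (lift 0 M) = lift 0 (subst 0 N M) :=
  subst_lift M N le_rfl

theorem cbvEnc_lift (M : Term R) : ∀ d : ℕ, cbvEnc (lift d M) = lift d (cbvEnc M) := by
  induction M with
  | var n =>
    intro d
    simp only [lift]
    split_ifs <;> simp [cbvEnc, lift, *]
  | lam M ih =>
    intro d
    simp [cbvEnc, lift, ih, lift_lift _ (Nat.succ_le_succ (Nat.zero_le d))]
  | app M N ihM ihN =>
    intro d
    simp [cbvEnc, lift, ihM, ihN, lift_lift _ (Nat.zero_le _)]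
  | zero => intros; rfl
  | smul a M ih => intro d; simp [cbvEnc, lift, ih, lift_lift _ (Nat.zero_le d)]
  | add M N ihM ihN =>
    intro d
    simp [cbvEnc, lift, ihM, ihN, lift_lift _ (Nat.zero_le d)]

theorem cbnEnc_lift (M : Term R) : ∀ d : ℕ, cbnEnc (lift d M) = lift d (cbnEnc M) := by
  induction M with
  | var n =>
    intro d
    simp only [lift, cbnEnc]
    split_ifs <;> rfl
  | lam M ih =>
    intro d
    simp [cbnEnc, lift, ih, lift_lift _ (Nat.succ_le_succ (Nat.zero_le d))]
  | app M N ihM ihN =>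
    intro d
    simp [cbnEnc, lift, ihM, ihN, lift_lift _ (Nat.zero_le _)]
  | zero => intro d; simp [cbnEnc, lift]
  | smul a M ih => intro d; simp [cbnEnc, lift, ih, lift_lift _ (Nat.zero_le d)]
  | add M N ihM ihN =>
    intro d
    simp [cbnEnc, lift, ihM, ihN, lift_lift _ (Nat.zero_le d)]

theorem IsBase.lift {B : Term R} (hB : IsBase B) (d : ℕ) : IsBase (B.lift d) := by
  cases hB with
  | var n => simp only [Term.lift]; split_ifs <;> constructor
  | lam M => exact .lam _

theorem IsBase.psi_lift {B : Term R} (hB : IsBase B) (d : ℕ) :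
    psi (B.lift d) = (psi B).lift d := by
  cases hB with
  | var n => simp only [Term.lift, psi]; split_ifs <;> rfl
  | lam M => simp only [Term.lift, psi, cbvEnc_lift]

theorem IsBase.cbvEnc_eq {B : Term R} (hB : IsBase B) :
    cbvEnc B = .lam (app (.var 0) ((psi B).lift 0)) := by
  cases hB <;> simp [cbvEnc, psi, Term.lift]

theorem cbvEnc_subst (M : Term R) : ∀ (d : ℕ) {B : Term R}, IsBase B →
    cbvEnc (subst d B M) = subst d (psi B) (cbvEnc M) := by
  induction M with
  | var n =>
    intro d B hB
    rcases lt_trichotomy n d with hn | rfl | hn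
    · simp [cbvEnc, subst, hn]
    · simp [cbvEnc, subst, hB.cbvEnc_eq]
    · have e : n - 1 + 1 = n := by omega
      simp [cbvEnc, subst, show ¬ n < d by omega, show ¬ n = d by omega, e]
  | lam M ih =>
    intro d B hB
    simp only [cbvEnc, subst, ih _ (hB.lift 0), hB.psi_lift, lift]
    rw [← lift_lift (psi B) le_rfl, subst_lift _ _ (by omega)]
    simp
  | app M N ihM ihN =>
    intro d B hB
    simp [cbvEnc, subst, ihM _ hB, ihN _ hB, subst_lift _ _ (Nat.zero_le _)]
  | zero => intros; rfl
  | smul a M ih =>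
    intro d B hB
    simp [cbvEnc, subst, ih _ hB, subst_lift _ _ (Nat.zero_le _)]
  | add M N ihM ihN =>
    intro d B hB
    simp [cbvEnc, subst, ihM _ hB, ihN _ hB, subst_lift _ _ (Nat.zero_le _)]

theorem cbnEnc_subst (M : Term R) : ∀ (d : ℕ) (N : Term R),
    cbnEnc (subst d N M) = subst d (cbnEnc N) (cbnEnc M) := by
  induction M with
  | var n =>
    intro d N
    simp only [cbnEnc, subst]
    split_ifs <;> rfl
  | lam M ih =>
    intro d N
    simp only [cbnEnc, subst, ih, cbnEnc_lift, lift]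
    rw [← lift_lift (cbnEnc N) le_rfl, subst_lift _ _ (by omega)]
    simp
  | app M L ihM ihL =>
    intro d N
    simp [cbnEnc, subst, ihM, ihL, subst_lift _ _ (Nat.zero_le _)]
  | zero => intro d N; simp [cbnEnc, subst]
  | smul a M ih =>
    intro d N
    simp [cbnEnc, subst, ih, subst_lift _ _ (Nat.zero_le _)]
  | add M L ihM ihL =>
    intro d N
    simp [cbnEnc, subst, ihM, ihL, subst_lift _ _ (Nat.zero_le _)]

theorem isBase_cbnEnc (M : Term R) : IsBase (cbnEnc M) := by
  cases M <;> constructor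

end Substitution

section Administrative

/-- The continuation that receives a function, then evaluates the encoded argument `N` and
    applies the function to it under the continuation `K`. -/
def cbvArgCont (N K : Term R) : Term R :=
  lam (app (lift 0 N) (lam (app (app (var 1) (var 0)) (lift 0 (lift 0 K)))))

/-- The continuation that applies the function `P` to the argument it receives, under the
    continuation `K`. -/
def cbvFunCont (P K : Term R) : Term R :=
  lam (app (app (lift 0 P) (var 0)) (lift 0 K))

theorem IsBase.colon {B : Term R} (hB : IsBase B) (K : Term R) :
    B.colon K = app K (psi B) := by
  cases hB <;> simp [Term.colon, psi]

theorem IsBase.colon_app {B : Term R} (hB : IsBase B) (N K : Term R) :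
    Term.colon (app B N) K = Term.colon N (cbvFunCont (psi B) K) := by
  cases hB <;> simp [Term.colon, psi, cbvFunCont, Term.lift]

theorem colon_app_app (M N L K : Term R) :
    colon (app (app M N) L) K = colon (app M N) (cbvArgCont (cbvEnc L) K) := by
  rw [colon, cbvArgCont]

/-- The continuation that applies the function it receives to the encoded argument `N`, under
    the continuation `K`. -/
def cbnArgCont (N K : Term R) : Term R :=
  lam (app (app (var 0) (lift 0 N)) (lift 0 K))

/-- The administrative operation of the call-by-name to call-by-value simulation on the
    application of `M` to an argument with encoding `N`. -/
def cbnColonApp : Term R → Term R → Term R → Term R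
  | var n, N, K => app (var n) (cbnArgCont N K)
  | lam M, N, K => app (app (lam (cbnEnc M)) N) K
  | app M L, N, K => cbnColonApp M (cbnEnc L) (cbnArgCont N K)
  | zero, _, _ => zero
  | smul a M, N, K => smul a (cbnColonApp M N K)
  | add M L, N, K => add (cbnColonApp M N K) (cbnColonApp L N K)

/-- The administrative operation of the call-by-name to call-by-value simulation. -/
def cbnColon : Term R → Term R → Term R
  | var n, K => app (var n) K
  | lam M, K => app K (lam (cbnEnc M))
  | app M N, K => cbnColonApp M (cbnEnc N) K
  | zero, _ => zero
  | smul a M, K => smul a (cbnColon M K)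
  | add M N, K => add (cbnColon M K) (cbnColon N K)

theorem isBase_cbnArgCont (N K : Term R) : IsBase (cbnArgCont N K) := .lam _

end Administrative

section Simulations

open Relation (ReflTransGen)

variable [CommRing R]

/-! ### Reductions in context -/

theorem StepAB.appL {M M' : Term R} (N : Term R) (h : ReflTransGen StepAB M M') :
    ReflTransGen StepAB (app M N) (app M' N) :=
  h.lift (app · N) fun _ _ h => h.imp (.ctxAppL N) (.ctxAppL N)

theorem StepAB.smul (a : R) {M M' : Term R} (h : ReflTransGen StepAB M M') :
    ReflTransGen StepAB (smul a M) (smul a M') :=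
  h.lift (Term.smul a) fun _ _ h => h.imp (.ctxSmul a) (.ctxSmul a)

theorem StepAB.add {M M' N N' : Term R} (hM : ReflTransGen StepAB M M')
    (hN : ReflTransGen StepAB N N') : ReflTransGen StepAB (add M N) (add M' N') :=
  (hM.lift (Term.add · N) fun _ _ h => h.imp (.ctxAddL N) (.ctxAddL N)).trans
    (hN.lift (Term.add M') fun _ _ h => h.imp (.ctxAddR M') (.ctxAddR M'))

theorem StepAB.beta {M N P : Term R} (h : subst 0 N M = P) :
    ReflTransGen StepAB (app (lam M) N) P :=
  .single (.inr (h ▸ .beta M N))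

theorem StepAB.alg {M N : Term R} (h : StepA M N) : ReflTransGen StepAB M N :=
  .single (.inl h)

theorem StepLB.appL {M M' : Term R} (N : Term R) (h : ReflTransGen StepLB M M') :
    ReflTransGen StepLB (app M N) (app M' N) :=
  h.lift (app · N) fun _ _ h => h.imp (.ctxAppL N) (.ctxAppL N)

theorem StepLB.smul (a : R) {M M' : Term R} (h : ReflTransGen StepLB M M') :
    ReflTransGen StepLB (smul a M) (smul a M') :=
  h.lift (Term.smul a) fun _ _ h => h.imp (.ctxSmul a) (.ctxSmul a)

theorem StepLB.add {M M' N N' : Term R} (hM : ReflTransGen StepLB M M')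
    (hN : ReflTransGen StepLB N N') : ReflTransGen StepLB (add M N) (add M' N') :=
  (hM.lift (Term.add · N) fun _ _ h => h.imp (.ctxAddL N) (.ctxAddL N)).trans
    (hN.lift (Term.add M') fun _ _ h => h.imp (.ctxAddR M') (.ctxAddR M'))

theorem StepLB.beta {M B P : Term R} (hB : IsBase B) (h : subst 0 B M = P) :
    ReflTransGen StepLB (app (lam M) B) P :=
  .single (.inr (h ▸ .beta M hB))

theorem StepLB.alg {M N : Term R} (h : StepL M N) : ReflTransGen StepLB M N :=
  .single (.inl h)

/-! ### Simulating call-by-value by call-by-name -/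

theorem colon_cbvArgCont {L : Term R}
    (hL : ∀ K, ReflTransGen StepAB (app (cbvEnc L) K) (colon L K)) (M : Term R) :
    ∀ K, ReflTransGen StepAB (colon M (cbvArgCont (cbvEnc L) K)) (colon (app M L) K) := by
  have base : ∀ {B : Term R}, IsBase B → ∀ K,
      ReflTransGen StepAB (colon B (cbvArgCont (cbvEnc L) K)) (colon (app B L) K) := by
    intro B hB K
    rw [hB.colon, hB.colon_app, cbvArgCont]
    refine (StepAB.beta ?_).trans (hL _)
    simp [subst, subst_lift_self, subst_one_lift, cbvFunCont]
  induction M with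
  | var n => exact base (.var n)
  | lam M => exact base (.lam M)
  | app M N => intro K; rw [colon_app_app]
  | zero => intro K; simp only [colon]; exact .refl
  | smul a M ih => intro K; simp only [colon]; exact StepAB.smul a (ih K)
  | add M N ihM ihN => intro K; simp only [colon]; exact StepAB.add (ihM K) (ihN K)

theorem app_cbvEnc_colon (M : Term R) :
    ∀ K, ReflTransGen StepAB (app (cbvEnc M) K) (colon M K) := by
  have base : ∀ {B : Term R}, IsBase B → ∀ K,
      ReflTransGen StepAB (app (cbvEnc B) K) (colon B K) := by
    intro B hB K
    rw [hB.colon, hB.cbvEnc_eq]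
    exact StepAB.beta (by simp [subst, subst_lift_self])
  induction M with
  | var n => exact base (.var n)
  | lam M => exact base (.lam M)
  | app M N ihM ihN =>
    intro K
    refine (StepAB.beta ?_).trans ((ihM _).trans (colon_cbvArgCont ihN M K))
    simp [subst, subst_lift_self, subst_one_lift, cbvArgCont]
  | zero => intro K; simp only [colon]; exact StepAB.alg (.appZero K)
  | smul a M ih =>
    intro K
    simp only [colon]
    refine (StepAB.beta (P := app (.smul a (cbvEnc M)) K) ?_).trans
      ((StepAB.alg (.appSmul a _ K)).trans (StepAB.smul a (ih K)))
    simp [subst, subst_lift_self]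
  | add M N ihM ihN =>
    intro K
    simp only [colon]
    refine (StepAB.beta (P := app (.add (cbvEnc M) (cbvEnc N)) K) ?_).trans
      ((StepAB.alg (.appAdd _ _ K)).trans (StepAB.add (ihM K) (ihN K)))
    simp [subst, subst_lift_self]

theorem colon_app_mono {P P' : Term R}
    (h : ∀ K, ReflTransGen StepAB (colon P K) (colon P' K)) {V : Term R} (hV : IsValue V) :
    ∀ K, ReflTransGen StepAB (colon (app V P) K) (colon (app V P') K) := by
  induction hV with
  | zero => intro K; simp only [colon]; exact .refl
  | base hB => intro K; rw [hB.colon_app, hB.colon_app]; exact h _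
  | smul a _ ih => intro K; simp only [colon]; exact StepAB.smul a (ih K)
  | add _ _ ih₁ ih₂ => intro K; simp only [colon]; exact StepAB.add (ih₁ K) (ih₂ K)

/-- A step out of an application is simulated in function position once it is simulated
    under every continuation. -/
theorem colon_app_of_colon {M N P : Term R}
    (h : ∀ K, ReflTransGen StepAB (colon (app M N) K) (colon P K)) (L K : Term R) :
    ReflTransGen StepAB (colon (app (app M N) L) K) (colon (app P L) K) := by
  rw [colon_app_app]
  exact (h _).trans (colon_cbvArgCont (app_cbvEnc_colon L) P K)

theorem StepL.colon {M N : Term R} (h : StepL M N) :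
    (∀ K, ReflTransGen StepAB (M.colon K) (N.colon K)) ∧
    ∀ L K, ReflTransGen StepAB ((app M L).colon K) ((app N L).colon K) := by
  have key : ∀ {M N P : Term R},
      (∀ K, ReflTransGen StepAB ((app M N).colon K) (P.colon K)) →
      (∀ K, ReflTransGen StepAB ((app M N).colon K) (P.colon K)) ∧
      ∀ L K, ReflTransGen StepAB ((app (app M N) L).colon K) ((app P L).colon K) :=
    fun h => ⟨h, colon_app_of_colon h⟩
  induction h with
  | assocL => constructor <;> intros <;> simp only [Term.colon] <;> exact StepAB.alg (.assocL _ _ _)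
  | assocR => constructor <;> intros <;> simp only [Term.colon] <;> exact StepAB.alg (.assocR _ _ _)
  | comm => constructor <;> intros <;> simp only [Term.colon] <;> exact StepAB.alg (.comm _ _)
  | factor => constructor <;> intros <;> simp only [Term.colon] <;> exact StepAB.alg (.factor _ _ _)
  | factor1 => constructor <;> intros <;> simp only [Term.colon] <;> exact StepAB.alg (.factor1 _ _)
  | factor11 => constructor <;> intros <;> simp only [Term.colon] <;> exact StepAB.alg (.factor11 _)
  | mulMul => constructor <;> intros <;> simp only [Term.colon] <;> exact StepAB.alg (.mulMul _ _ _)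
  | mulDist => constructor <;> intros <;> simp only [Term.colon] <;> exact StepAB.alg (.mulDist _ _ _)
  | oneSmul => constructor <;> intros <;> simp only [Term.colon] <;> exact StepAB.alg (.oneSmul _)
  | zeroSmul => constructor <;> intros <;> simp only [Term.colon] <;> exact StepAB.alg (.zeroSmul _)
  | smulZero => constructor <;> intros <;> simp only [Term.colon] <;> exact StepAB.alg (.smulZero _)
  | zeroAdd => constructor <;> intros <;> simp only [Term.colon] <;> exact StepAB.alg (.zeroAdd _)
  | appAddV | appSmulV | appZeroV =>
    refine key fun K => ?_
    simp only [Term.colon]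
    exact .refl
  | appAddB _ _ hB | appSmulB _ _ hB | appZeroB hB =>
    refine key fun K => ?_
    simp only [hB.colon_app, Term.colon]
    exact .refl
  | ctxAppL N _ ih => exact key (ih.2 N)
  | ctxAddL N _ ih =>
    constructor <;> intros <;> simp only [Term.colon]
    · exact StepAB.add (ih.1 _) .refl
    · exact StepAB.add (ih.2 _ _) .refl
  | ctxAddR M _ ih =>
    constructor <;> intros <;> simp only [Term.colon]
    · exact StepAB.add .refl (ih.1 _)
    · exact StepAB.add .refl (ih.2 _ _)
  | ctxSmul a _ ih =>
    constructor <;> intros <;> simp only [Term.colon]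
    · exact StepAB.smul a (ih.1 _)
    · exact StepAB.smul a (ih.2 _ _)
  | ctxAppR hV _ ih => exact key (colon_app_mono ih.1 hV)

theorem StepBv.colon {M N : Term R} (h : StepBv M N) :
    (∀ K, ReflTransGen StepAB (M.colon K) (N.colon K)) ∧
    ∀ L K, ReflTransGen StepAB ((app M L).colon K) ((app N L).colon K) := by
  have key : ∀ {M N P : Term R},
      (∀ K, ReflTransGen StepAB ((app M N).colon K) (P.colon K)) →
      (∀ K, ReflTransGen StepAB ((app M N).colon K) (P.colon K)) ∧
      ∀ L K, ReflTransGen StepAB ((app (app M N) L).colon K) ((app P L).colon K) :=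
    fun h => ⟨h, colon_app_of_colon h⟩
  induction h with
  | beta M hB =>
    refine key fun K => ?_
    rw [(IsBase.lam M).colon_app, hB.colon, cbvFunCont]
    refine .trans ?_ (app_cbvEnc_colon _ K)
    rw [cbvEnc_subst M 0 hB]
    refine (StepAB.beta ?_).trans (StepAB.appL K (StepAB.beta rfl))
    simp [subst, subst_lift_self, psi]
  | ctxAppL N _ ih => exact key (ih.2 N)
  | ctxAddL N _ ih =>
    constructor <;> intros <;> simp only [Term.colon]
    · exact StepAB.add (ih.1 _) .refl
    · exact StepAB.add (ih.2 _ _) .refl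
  | ctxAddR M _ ih =>
    constructor <;> intros <;> simp only [Term.colon]
    · exact StepAB.add .refl (ih.1 _)
    · exact StepAB.add .refl (ih.2 _ _)
  | ctxSmul a _ ih =>
    constructor <;> intros <;> simp only [Term.colon]
    · exact StepAB.smul a (ih.1 _)
    · exact StepAB.smul a (ih.2 _ _)
  | ctxAppR hV _ ih => exact key (colon_app_mono ih.1 hV)

theorem StepLB.colon {M N : Term R} (h : ReflTransGen StepLB M N) (K : Term R) :
    ReflTransGen StepAB (M.colon K) (N.colon K) := by
  induction h with
  | refl => exact .refl
  | tail _ h ih => exact ih.trans (h.elim (fun h => h.colon.1 K) (fun h => h.colon.1 K))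

theorem IsValue.colon_id {V : Term R} (hV : IsValue V) :
    ReflTransGen StepAB (V.colon (.lam (var 0))) (psi V) := by
  induction hV with
  | zero => simp only [Term.colon, psi]; exact .refl
  | base hB => rw [hB.colon]; exact StepAB.beta (by simp [subst])
  | smul a _ ih => simp only [Term.colon, psi]; exact StepAB.smul a ih
  | add _ _ ih₁ ih₂ => simp only [Term.colon, psi]; exact StepAB.add ih₁ ih₂

/-- Call-by-name reduction simulates call-by-value reduction to a value. -/
theorem StepLB.simulation {M V : Term R} (hV : IsValue V) (h : ReflTransGen StepLB M V) :
    ReflTransGen StepAB (app (cbvEnc M) (lam (var 0))) (psi V) :=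
  (app_cbvEnc_colon M _).trans ((StepLB.colon h _).trans hV.colon_id)

/-! ### Simulating call-by-name by call-by-value -/

theorem cbnColon_cbnArgCont (M N K : Term R) :
    ReflTransGen StepLB (cbnColon M (cbnArgCont N K)) (cbnColonApp M N K) := by
  induction M with
  | var n => exact .refl
  | lam M =>
    refine StepLB.beta (.lam _) ?_
    simp [subst, subst_lift_self, cbnColonApp]
  | app M L => exact .refl
  | zero => exact .refl
  | smul a M ih => exact StepLB.smul a ih
  | add M L ihM ihL => exact StepLB.add ihM ihL

theorem app_cbnEnc_cbnColon (M : Term R) : ∀ {K : Term R}, IsBase K →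
    ReflTransGen StepLB (app (cbnEnc M) K) (cbnColon M K) := by
  induction M with
  | var n => exact fun _ => .refl
  | lam M =>
    intro K hK
    refine StepLB.beta hK ?_
    rw [subst, subst, subst_lift_self]
    simp [cbnColon]
  | app M N ihM =>
    intro K hK
    refine (StepLB.beta hK ?_).trans
      ((ihM (isBase_cbnArgCont (cbnEnc N) K)).trans (cbnColon_cbnArgCont M (cbnEnc N) K))
    simp [subst, subst_lift_self, subst_one_lift, cbnArgCont]
  | zero =>
    intro K hK
    refine (StepLB.beta hK ?_).trans (StepLB.alg (.appZeroV (.base hK)))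
    simp [subst]
  | smul a M ih =>
    intro K hK
    refine (StepLB.beta (P := app (.smul a (cbnEnc M)) K) hK ?_).trans
      ((StepLB.alg (.appSmulV a _ (.base hK))).trans (StepLB.smul a (ih hK)))
    simp [subst, subst_lift_self]
  | add M N ihM ihN =>
    intro K hK
    refine (StepLB.beta (P := app (.add (cbnEnc M) (cbnEnc N)) K) hK ?_).trans
      ((StepLB.alg (.appAddV _ _ (.base hK))).trans (StepLB.add (ihM hK) (ihN hK)))
    simp [subst, subst_lift_self]

theorem cbnColonApp_app_of_cbnColon {M N P : Term R}
    (h : ∀ {K}, IsBase K → ReflTransGen StepLB (cbnColon (app M N) K) (cbnColon P K))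
    (L K : Term R) :
    ReflTransGen StepLB (cbnColonApp (app M N) L K) (cbnColonApp P L K) :=
  (h (isBase_cbnArgCont L K)).trans (cbnColon_cbnArgCont P L K)

theorem StepA.cbnColon {M N : Term R} (h : StepA M N) :
    (∀ {K}, IsBase K → ReflTransGen StepLB (M.cbnColon K) (N.cbnColon K)) ∧
    ∀ L {K}, IsBase K → ReflTransGen StepLB (M.cbnColonApp L K) (N.cbnColonApp L K) := by
  induction h with
  | assocL => constructor <;> intros <;> exact StepLB.alg (.assocL _ _ _)
  | assocR => constructor <;> intros <;> exact StepLB.alg (.assocR _ _ _)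
  | comm => constructor <;> intros <;> exact StepLB.alg (.comm _ _)
  | factor => constructor <;> intros <;> exact StepLB.alg (.factor _ _ _)
  | factor1 => constructor <;> intros <;> exact StepLB.alg (.factor1 _ _)
  | factor11 => constructor <;> intros <;> exact StepLB.alg (.factor11 _)
  | mulMul => constructor <;> intros <;> exact StepLB.alg (.mulMul _ _ _)
  | mulDist => constructor <;> intros <;> exact StepLB.alg (.mulDist _ _ _)
  | oneSmul => constructor <;> intros <;> exact StepLB.alg (.oneSmul _)
  | zeroSmul => constructor <;> intros <;> exact StepLB.alg (.zeroSmul _)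
  | smulZero => constructor <;> intros <;> exact StepLB.alg (.smulZero _)
  | zeroAdd => constructor <;> intros <;> exact StepLB.alg (.zeroAdd _)
  | appAdd | appSmul | appZero => exact ⟨fun _ => .refl, fun _ _ _ => .refl⟩
  | ctxAppL N _ ih =>
    exact ⟨ih.2 _, fun L K _ => cbnColonApp_app_of_cbnColon (ih.2 _) L K⟩
  | ctxAddL N _ ih => exact ⟨fun hK => StepLB.add (ih.1 hK) .refl, fun L _ hK => StepLB.add (ih.2 L hK) .refl⟩
  | ctxAddR M _ ih => exact ⟨fun hK => StepLB.add .refl (ih.1 hK), fun L _ hK => StepLB.add .refl (ih.2 L hK)⟩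
  | ctxSmul a _ ih => exact ⟨fun hK => StepLB.smul a (ih.1 hK), fun L _ hK => StepLB.smul a (ih.2 L hK)⟩

theorem StepBn.cbnColon {M N : Term R} (h : StepBn M N) :
    (∀ {K}, IsBase K → ReflTransGen StepLB (M.cbnColon K) (N.cbnColon K)) ∧
    ∀ L {K}, IsBase K → ReflTransGen StepLB (M.cbnColonApp L K) (N.cbnColonApp L K) := by
  induction h with
  | beta M N =>
    have h : ∀ {K}, IsBase K →
        ReflTransGen StepLB ((app (.lam M) N).cbnColon K) ((subst 0 N M).cbnColon K) :=
      fun {K} hK => .trans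
        (StepLB.appL K (StepLB.beta (isBase_cbnEnc N) (cbnEnc_subst M 0 N).symm))
        (app_cbnEnc_cbnColon _ hK)
    exact ⟨h, fun L K _ => cbnColonApp_app_of_cbnColon h L K⟩
  | ctxAppL N _ ih =>
    exact ⟨ih.2 _, fun L K _ => cbnColonApp_app_of_cbnColon (ih.2 _) L K⟩
  | ctxAddL N _ ih => exact ⟨fun hK => StepLB.add (ih.1 hK) .refl, fun L _ hK => StepLB.add (ih.2 L hK) .refl⟩
  | ctxAddR M _ ih => exact ⟨fun hK => StepLB.add .refl (ih.1 hK), fun L _ hK => StepLB.add .refl (ih.2 L hK)⟩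
  | ctxSmul a _ ih => exact ⟨fun hK => StepLB.smul a (ih.1 hK), fun L _ hK => StepLB.smul a (ih.2 L hK)⟩

theorem StepAB.cbnColon {M N : Term R} (h : ReflTransGen StepAB M N) {K : Term R}
    (hK : IsBase K) : ReflTransGen StepLB (M.cbnColon K) (N.cbnColon K) := by
  induction h with
  | refl => exact .refl
  | tail _ h ih => exact ih.trans (h.elim (fun h => h.cbnColon.1 hK) (fun h => h.cbnColon.1 hK))

theorem IsValue.cbnColon_id {V : Term R} (hV : IsValue V) :
    ReflTransGen StepLB (V.cbnColon (.lam (var 0))) (phi V) := by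
  induction hV with
  | zero => exact .refl
  | base hB =>
    cases hB with
    | var n => exact .refl
    | lam M => exact StepLB.beta (.lam _) (by simp [subst, phi])
  | smul a _ ih => exact StepLB.smul a ih
  | add _ _ ih₁ ih₂ => exact StepLB.add ih₁ ih₂

/-- Call-by-value reduction simulates call-by-name reduction to a value. -/
theorem StepAB.simulation {M V : Term R} (hV : IsValue V) (h : ReflTransGen StepAB M V) :
    ReflTransGen StepLB (app (cbnEnc M) (lam (var 0))) (phi V) :=
  (app_cbnEnc_cbnColon M (.lam _)).trans ((StepAB.cbnColon h (.lam _)).trans hV.cbnColon_id)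

end Simulations

section Statements

variable [CommRing R]

/-- composed simulations without confluence: for every closed term `M`
and value `V`, (i) if `M →ℓ∪β* V` then `(M~) λx.x (=a∪β)* Ψ(V)`, and
(ii) if `M →a∪β* V` then `(⟦M⟧) λx.x (=ℓ∪β)* Φ(V)`. -/
theorem composed_simulations_without_confluence :
    (∀ M V : Term R, Closed M → IsValue V → Relation.ReflTransGen StepLB M V →
      Relation.ReflTransGen EqABfull (app (cbvEnc M) (lam (var 0))) (psi V)) ∧
    (∀ M V : Term R, Closed M → IsValue V → Relation.ReflTransGen StepAB M V →
      Relation.ReflTransGen EqLBfull (app (cbnEnc M) (lam (var 0))) (phi V)) := by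
  exact ⟨fun _ _ _ hV h =>
      Relation.ReflTransGen.mono (fun _ _ h => h.imp_left .inl) _ _ (StepLB.simulation hV h),
    fun _ _ _ hV h =>
      Relation.ReflTransGen.mono (fun _ _ h => h.imp_left .inl) _ _ (StepAB.simulation hV h)⟩

end Statements

end Term

end AlgLam
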